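/- A finite simple graph G is bγ-perfect (for every induced subgraph H, the b-chromatic number of H equals the pseudo-Grundy number of H) if and only if G has no induced subgraph isomorphic to C4, P4, 3P3, or 2D. -/

import Mathlib

open SimpleGraph

/-- A `k`-coloring `c` of `G` is *complete* if it is surjective and for every pair of distinct
colors there is an edge of `G` whose endpoints receive those two colors. -/
def IsCompleteColoring {V : Type*} (G : SimpleGraph V) {k : ℕ} (c : V → Fin k) : Prop :=
  Function.Surjective c ∧
    ∀ i j : Fin k, i ≠ j → ∃ u v : V, G.Adj u v ∧ c u = i ∧ c v = j

/-- A coloring is *proper* if adjacent vertices receive distinct colors. -/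
def IsProperColoring {V : Type*} (G : SimpleGraph V) {k : ℕ} (c : V → Fin k) : Prop :=
  ∀ u v : V, G.Adj u v → c u ≠ c v

/-- A `k`-coloring `c` of `G` is *dominating* if it is surjective and every color class contains
a vertex having a neighbor in every other color class. -/
def IsDominatingColoring {V : Type*} (G : SimpleGraph V) {k : ℕ} (c : V → Fin k) : Prop :=
  Function.Surjective c ∧
    ∀ i : Fin k, ∃ v : V, c v = i ∧ ∀ j : Fin k, j ≠ i → ∃ u : V, G.Adj v u ∧ c u = j

/-- A `k`-coloring `c` of `G` is *pseudo-Grundy* if it is surjective and every vertex is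
adjacent to at least one vertex of each smaller color. -/
def IsPseudoGrundyColoring {V : Type*} (G : SimpleGraph V) {k : ℕ} (c : V → Fin k) : Prop :=
  Function.Surjective c ∧
    ∀ v : V, ∀ j : Fin k, j < c v → ∃ u : V, G.Adj v u ∧ c u = j

/-- The pseudoachromatic number `ψ(G)`: the largest `k` admitting a complete `k`-coloring. -/
noncomputable def pseudoachromaticNumber {V : Type*} (G : SimpleGraph V) : ℕ :=
  sSup {k | ∃ c : V → Fin k, IsCompleteColoring G c}

/-- The achromatic number `α(G)`: the largest `k` admitting a proper complete `k`-coloring. -/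
noncomputable def achromaticNumber {V : Type*} (G : SimpleGraph V) : ℕ :=
  sSup {k | ∃ c : V → Fin k, IsProperColoring G c ∧ IsCompleteColoring G c}

/-- The b-chromatic number `b(G)`: the largest `k` admitting a proper dominating `k`-coloring. -/
noncomputable def bChromaticNumber {V : Type*} (G : SimpleGraph V) : ℕ :=
  sSup {k | ∃ c : V → Fin k, IsProperColoring G c ∧ IsDominatingColoring G c}

/-- The pseudo-b-chromatic number `B(G)`: the largest `k` admitting a dominating `k`-coloring. -/
noncomputable def pseudoBChromaticNumber {V : Type*} (G : SimpleGraph V) : ℕ :=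
  sSup {k | ∃ c : V → Fin k, IsDominatingColoring G c}

/-- The Grundy number `Γ(G)`: the largest `k` admitting a proper pseudo-Grundy `k`-coloring. -/
noncomputable def grundyNumber {V : Type*} (G : SimpleGraph V) : ℕ :=
  sSup {k | ∃ c : V → Fin k, IsProperColoring G c ∧ IsPseudoGrundyColoring G c}

/-- The pseudo-Grundy number `γ(G)`: the largest `k` admitting a pseudo-Grundy `k`-coloring. -/
noncomputable def pseudoGrundyNumber {V : Type*} (G : SimpleGraph V) : ℕ :=
  sSup {k | ∃ c : V → Fin k, IsPseudoGrundyColoring G c}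

/-- `G` contains the complete graph `K_k` as a minor: there are `k` pairwise disjoint
"branch sets", each inducing a connected (nonempty) subgraph, with an edge of `G` between
every two of them. -/
def HasCompleteMinor {V : Type*} (G : SimpleGraph V) (k : ℕ) : Prop :=
  ∃ B : Fin k → Set V,
    (∀ i, (G.induce (B i)).Connected) ∧
    (∀ i j : Fin k, i ≠ j → Disjoint (B i) (B j)) ∧
    (∀ i j : Fin k, i ≠ j → ∃ u ∈ B i, ∃ v ∈ B j, G.Adj u v)

/-- The Hadwiger number `h(G)`: the largest `k` such that `K_k` is a minor of `G`. -/
noncomputable def hadwigerNumber {V : Type*} (G : SimpleGraph V) : ℕ :=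
  sSup {k | HasCompleteMinor G k}

/-- `G` has an induced subgraph isomorphic to `H`. -/
def HasInducedCopy {V : Type*} {W : Type*} (G : SimpleGraph V) (H : SimpleGraph W) : Prop :=
  ∃ s : Set V, Nonempty (G.induce s ≃g H)

/-- A graph is *chordal* if it has no induced cycle on four or more vertices. -/
def IsChordal {V : Type*} (G : SimpleGraph V) : Prop :=
  ∀ n : ℕ, 4 ≤ n → ¬ HasInducedCopy G (cycleGraph n)

/-- The diamond graph `D`: `K₄` minus one edge. -/
def diamondGraph : SimpleGraph (Fin 4) :=
  (⊤ : SimpleGraph (Fin 4)).deleteEdges {s(0, 1)}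

namespace BG

/-- Nested closed neighbourhoods on edges: no induced `P₄` or `C₄` centred at an edge. -/
def Nested {V : Type*} (G : SimpleGraph V) : Prop :=
  ∀ u v a b : V, G.Adj u v → G.Adj a u → a ≠ v → ¬ G.Adj a v → G.Adj b v → b ≠ u →
    ¬ G.Adj b u → False

/-- Induced path on three vertices centred at `x`. -/
def P3 {V : Type*} (G : SimpleGraph V) (x a b : V) : Prop :=
  G.Adj x a ∧ G.Adj x b ∧ a ≠ b ∧ ¬ G.Adj a b

/-- Induced diamond with central edge `x y`. -/
def Dia {V : Type*} (G : SimpleGraph V) (x y a b : V) : Prop :=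
  G.Adj x y ∧ P3 G x a b ∧ P3 G y a b

/-- No common vertices and no edges between the two sets. -/
def Anti {V : Type*} (G : SimpleGraph V) (s t : Set V) : Prop :=
  ∀ x ∈ s, ∀ y ∈ t, x ≠ y ∧ ¬ G.Adj x y

/-- Membership in the closed neighbourhood of `r`. -/
def Cl {V : Type*} (G : SimpleGraph V) (r v : V) : Prop := v = r ∨ G.Adj r v

/-- The closed neighbourhood of `r` inside `A` is closed under adjacency inside `A`. -/
def Root {V : Type*} (G : SimpleGraph V) (A : Finset V) (r : V) : Prop :=
  r ∈ A ∧ ∀ a ∈ A, ∀ b ∈ A, Cl G r a → G.Adj a b → Cl G r b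

/-- `v` dominates all colours of `S` inside `A`. -/
def BV {V κ : Type*} (G : SimpleGraph V) (c : V → κ) (A : Finset V) (S : Finset κ) (i : κ)
    (v : V) : Prop :=
  v ∈ A ∧ c v = i ∧ ∀ j ∈ S, j ≠ i → ∃ u ∈ A, G.Adj v u ∧ c u = j

section
open Classical

variable {V κ : Type*} {G : SimpleGraph V} {c : V → κ} {A : Finset V} {S : Finset κ}

theorem exists_root (hN : Nested G) {v : V} (hv : v ∈ A) : ∃ r, Root G A r ∧ Cl G r v := by
  obtain ⟨r, hr, hmax⟩ := Finset.exists_max_image (A.filter (fun r => Cl G r v))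
    (fun r => (A.filter (fun x => Cl G r x)).card) ⟨v, Finset.mem_filter.2 ⟨hv, Or.inl rfl⟩⟩
  rw [Finset.mem_filter] at hr
  refine ⟨r, ⟨hr.1, ?_⟩, hr.2⟩
  intro a ha b hb hra hab
  by_contra hrb
  have hne : a ≠ r := by rintro rfl; exact hrb (Or.inr hab)
  have har : G.Adj r a := by rcases hra with h | h; exacts [absurd h hne, h]
  have hbr : b ≠ r ∧ ¬ G.Adj r b := by simpa [Cl, not_or] using hrb
  have key : ∀ x, Cl G r x → Cl G a x := by
    intro x hx
    by_contra hax
    have hax' : x ≠ a ∧ ¬ G.Adj a x := by simpa [Cl, not_or] using hax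
    rcases hx with rfl | hx
    · exact hax'.2 har.symm
    · exact hN r a x b har hx.symm hax'.1 (fun h => hax'.2 h.symm) hab.symm hbr.1
        (fun h => hbr.2 h.symm)
  have h1 := hmax a (by simp [ha, key v hr.2])
  have h2 : A.filter (fun x => Cl G r x) ⊂ A.filter (fun x => Cl G a x) := by
    rw [Finset.ssubset_iff_of_subset]
    · exact ⟨b, Finset.mem_filter.2 ⟨hb, Or.inr hab⟩, by simp [hrb]⟩
    · intro x hx
      rw [Finset.mem_filter] at hx ⊢
      exact ⟨hx.1, key x hx.2⟩
  exact absurd (Finset.card_lt_card h2) (by simpa using h1)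

theorem center {i : κ} {v : V} (hi : i ∈ S) (hb : BV G c A S i v)
    (hno : ¬ ∃ K ⊆ A, G.IsNClique S.card K) : ∃ a ∈ A, ∃ b ∈ A, P3 G v a b := by
  by_contra hcon
  apply hno
  have hb3 : ∀ j : κ, ∃ u, j ∈ S → u ∈ A ∧ c u = j ∧ (u = v ∨ G.Adj v u) := by
    intro j
    by_cases hj : j ∈ S
    · by_cases hji : j = i
      · exact ⟨v, fun _ => ⟨hb.1, hji ▸ hb.2.1, Or.inl rfl⟩⟩
      · obtain ⟨u, hu, h1, h2⟩ := hb.2.2 j hj hji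
        exact ⟨u, fun _ => ⟨hu, h2, Or.inr h1⟩⟩
    · exact ⟨v, fun h => absurd h hj⟩
  choose f hf using hb3
  refine ⟨S.image f, ?_, ?_, ?_⟩
  · intro x hx
    obtain ⟨j, hj, rfl⟩ := Finset.mem_image.1 hx
    exact (hf j hj).1
  · intro x hx y hy hxy
    obtain ⟨j, hj, rfl⟩ := Finset.mem_image.1 (Finset.mem_coe.1 hx)
    obtain ⟨l, hl, rfl⟩ := Finset.mem_image.1 (Finset.mem_coe.1 hy)
    obtain ⟨hj1, -, hj2⟩ := hf j hj
    obtain ⟨hl1, -, hl2⟩ := hf l hl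
    by_contra hadj
    rcases hj2 with hj2 | hj2
    · rcases hl2 with hl2 | hl2
      · exact hxy (hj2.trans hl2.symm)
      · rw [hj2] at hadj; exact hadj hl2
    · rcases hl2 with hl2 | hl2
      · rw [hl2] at hadj; exact hadj hj2.symm
      · exact hcon ⟨_, hj1, _, hl1, hj2, hl2, hxy, hadj⟩
  · apply Finset.card_image_of_injOn
    intro j hj l hl h
    have h1 := (hf j hj).2.1
    have h2 := (hf l hl).2.1
    rw [← h1, ← h2]; exact congrArg c h

theorem BV.restrict {i : κ} {v r : V} (hr : Root G A r) (hb : BV G c A S i v) (hv : Cl G r v) :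
    BV G c (A.filter (fun x => Cl G r x)) S i v := by
  refine ⟨by simp [hb.1, hv], hb.2.1, ?_⟩
  intro j hj hji
  obtain ⟨u, hu, h1, h2⟩ := hb.2.2 j hj hji
  exact ⟨u, by simp [hu, hr.2 v hb.1 u hu hv h1], h1, h2⟩

theorem BV.step {i : κ} {v r : V} (hr : Root G A r) (hb : BV G c A S i v) (hv : Cl G r v)
    (hi : i ≠ c r) : BV G c (A.filter (fun x => G.Adj r x)) (S.erase (c r)) i v := by
  have aux : ∀ x, Cl G r x → c x ≠ c r → G.Adj r x := by
    rintro x (rfl | h) h'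
    · exact absurd rfl h'
    · exact h
  refine ⟨?_, hb.2.1, ?_⟩
  · rw [Finset.mem_filter]
    exact ⟨hb.1, aux v hv (by rw [hb.2.1]; exact hi)⟩
  · intro j hj hji
    rw [Finset.mem_erase] at hj
    obtain ⟨u, hu, h1, h2⟩ := hb.2.2 j hj.2 hji
    refine ⟨u, ?_, h1, h2⟩
    rw [Finset.mem_filter]
    exact ⟨hu, aux u (hr.2 v hb.1 u hu hv h1) (by rw [h2]; exact hj.1)⟩

theorem BV.appear {i : κ} {v : V} (hb : BV G c A S i v) {j : κ} (hj : j ∈ S) :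
    ∃ u ∈ A, c u = j := by
  by_cases h : j = i
  · exact ⟨v, hb.1, h ▸ hb.2.1⟩
  · obtain ⟨u, hu, -, h2⟩ := hb.2.2 j hj h
    exact ⟨u, hu, h2⟩

theorem BV.step_appear {i : κ} {v r : V} (hr : Root G A r) (hb : BV G c A S i v) (hv : Cl G r v)
    {j : κ} (hj : j ∈ S.erase (c r)) : ∃ u ∈ A.filter (fun x => G.Adj r x), c u = j := by
  obtain ⟨u, hu, h⟩ := (hb.restrict hr hv).appear (Finset.mem_of_mem_erase hj)
  rw [Finset.mem_filter] at hu
  refine ⟨u, ?_, h⟩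
  rw [Finset.mem_filter]
  refine ⟨hu.1, ?_⟩
  rcases hu.2 with h' | h'
  · rw [Finset.mem_erase] at hj
    exact absurd (by rw [← h, h']) hj.1
  · exact h'

theorem step_colors (hc : ∀ u v, G.Adj u v → c u ≠ c v) (hS : ∀ a ∈ A, c a ∈ S) {r : V} :
    ∀ a ∈ A.filter (fun x => G.Adj r x), c a ∈ S.erase (c r) := by
  intro a ha
  rw [Finset.mem_filter] at ha
  rw [Finset.mem_erase]
  exact ⟨(hc _ _ ha.2).symm, hS a ha.1⟩

theorem step_clique {r : V} (hr : r ∈ A) (hS : c r ∈ S)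
    (h : ∃ K ⊆ A.filter (fun x => G.Adj r x), G.IsNClique (S.erase (c r)).card K) :
    ∃ K ⊆ A, G.IsNClique S.card K := by
  obtain ⟨K, hK, hcl⟩ := h
  refine ⟨insert r K, ?_, ?_⟩
  · intro x hx
    rcases Finset.mem_insert.1 hx with rfl | hx
    · exact hr
    · exact (Finset.mem_filter.1 (hK hx)).1
  · have := hcl.insert (a := r) (fun b hb => (Finset.mem_filter.1 (hK hb)).2)
    rwa [Finset.card_erase_add_one hS] at this

/-- Paths at vertices in and outside of the closed neighbourhood of a root are anticomplete. -/
theorem root_anti {r v w a b a' b' : V} (hr : Root G A r) (hv : v ∈ A) (hw : w ∈ A)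
    (ha : a ∈ A) (hb : b ∈ A) (ha' : a' ∈ A) (hb' : b' ∈ A) (hrv : Cl G r v) (hrw : ¬ Cl G r w)
    (h : P3 G v a b) (h' : P3 G w a' b') : Anti G {v, a, b} {w, a', b'} := by
  have h1 : ∀ x ∈ ({v, a, b} : Set V), x ∈ A ∧ Cl G r x := by
    rintro x (rfl | rfl | rfl)
    exacts [⟨hv, hrv⟩, ⟨ha, hr.2 _ hv _ ha hrv h.1⟩, ⟨hb, hr.2 _ hv _ hb hrv h.2.1⟩]
  have h2 : ∀ x ∈ ({w, a', b'} : Set V), x ∈ A ∧ ¬ Cl G r x := by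
    rintro x (rfl | rfl | rfl)
    exacts [⟨hw, hrw⟩, ⟨ha', fun hx => hrw (hr.2 _ ha' _ hw hx h'.1.symm)⟩,
      ⟨hb', fun hx => hrw (hr.2 _ hb' _ hw hx h'.2.1.symm)⟩]
  intro x hx y hy
  refine ⟨?_, ?_⟩
  · rintro rfl; exact (h2 _ hy).2 (h1 _ hx).2
  · intro hxy; exact (h2 _ hy).2 (hr.2 _ (h1 _ hx).1 _ (h2 _ hy).1 (h1 _ hx).2 hxy)

theorem L2 (hN : Nested G) (hc : ∀ u v, G.Adj u v → c u ≠ c v) (e : κ) :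
    ∀ (n : ℕ) (A : Finset V) (S : Finset κ), S.card = n → (∀ a ∈ A, c a ∈ S) →
      (∀ x ∈ A, ∀ a ∈ A, ∀ b ∈ A, ∀ x' ∈ A, ∀ a' ∈ A, ∀ b' ∈ A, P3 G x a b → P3 G x' a' b' →
        ¬ Anti G {x, a, b} {x', a', b'}) →
      (∀ i ∈ S, ∃ u ∈ A, c u = i) →
      (∀ i ∈ S, i ≠ e → ∃ v, BV G c A S i v) →
      ∃ K ⊆ A, G.IsNClique S.card K := by
  intro n
  induction n with
  | zero =>
    intro A S hS _ _ _ _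
    exact ⟨∅, by simp, by rw [hS]; simp [isNClique_iff]⟩
  | succ n ih =>
    intro A S hS hcol h2 happ hbv
    by_cases h1 : S.card = 1
    · obtain ⟨i, hi⟩ := Finset.card_eq_one.1 h1
      obtain ⟨u, hu, -⟩ := happ i (by simp [hi])
      exact ⟨{u}, by simpa using hu, by rw [h1]; simp [isNClique_iff]⟩
    by_contra hno
    obtain ⟨i0, hi0, hne⟩ := Finset.exists_mem_ne (by omega : 1 < S.card) e
    obtain ⟨v0, hv0⟩ := hbv i0 hi0 hne
    obtain ⟨r, hr, hrv⟩ := exists_root hN hv0.1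
    obtain ⟨a, ha, b, hb, hp⟩ := center hi0 hv0 hno
    apply hno
    apply step_clique hr.1 (hcol r hr.1)
    apply ih
    · rw [Finset.card_erase_of_mem (hcol r hr.1)]; omega
    · exact step_colors hc hcol
    · intro x hx a hxa b hxb y hy a' hya b' hyb
      exact h2 x (Finset.mem_filter.1 hx).1 a (Finset.mem_filter.1 hxa).1 b
        (Finset.mem_filter.1 hxb).1 y (Finset.mem_filter.1 hy).1 a' (Finset.mem_filter.1 hya).1 b'
        (Finset.mem_filter.1 hyb).1
    · intro i hi
      exact hv0.step_appear hr hrv hi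
    · intro i hi hie
      rw [Finset.mem_erase] at hi
      obtain ⟨v, hv⟩ := hbv i hi.2 hie
      refine ⟨v, hv.step hr ?_ hi.1⟩
      by_contra hrv'
      obtain ⟨a', ha', b', hb', hp'⟩ := center hi.2 hv hno
      exact h2 v0 hv0.1 a ha b hb v hv.1 a' ha' b' hb' hp hp'
        (root_anti hr hv0.1 hv.1 ha hb ha' hb' hrv hrv' hp hp')

theorem diamond_aux {r v a b : V} (hr : Root G A r) (hv : v ∈ A) (ha : a ∈ A) (hb : b ∈ A)
    (hrv : Cl G r v) (hne : v ≠ r) (hp : P3 G v a b) : Dia G r v a b := by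
  have hra := hr.2 v hv a ha hrv hp.1
  have hrb := hr.2 v hv b hb hrv hp.2.1
  have hrv' : G.Adj r v := by rcases hrv with h | h; exacts [absurd h hne, h]
  obtain ⟨h1, h2, h3, h4⟩ := hp
  refine ⟨hrv', ⟨?_, ?_, h3, h4⟩, h1, h2, h3, h4⟩
  · rcases hra with rfl | h
    · rcases hrb with rfl | h
      · exact absurd rfl h3
      · exact absurd h h4
    · exact h
  · rcases hrb with rfl | h
    · rcases hra with rfl | h
      · exact absurd rfl h3
      · exact absurd h.symm h4
    · exact h

theorem diamond {r v w : V} {i j : κ} (hr : Root G A r) (hi : i ∈ S) (hj : j ∈ S) (hij : i ≠ j)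
    (hv : BV G c A S i v) (hw : BV G c A S j w) (hrv : Cl G r v) (hrw : Cl G r w)
    (hno : ¬ ∃ K ⊆ A, G.IsNClique S.card K) :
    ∃ x ∈ A, ∃ y ∈ A, ∃ a ∈ A, ∃ b ∈ A, Dia G x y a b ∧
      ∀ z ∈ ({x, y, a, b} : Set V), z ∈ A ∧ Cl G r z := by
  have main : ∀ (i : κ) (v : V), i ∈ S → BV G c A S i v → Cl G r v → v ≠ r →
    ∃ x ∈ A, ∃ y ∈ A, ∃ a ∈ A, ∃ b ∈ A, Dia G x y a b ∧
      ∀ z ∈ ({x, y, a, b} : Set V), z ∈ A ∧ Cl G r z := by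
    intro i v hi hv hrv hne
    obtain ⟨a, ha, b, hb, hp⟩ := center hi hv hno
    refine ⟨r, hr.1, v, hv.1, a, ha, b, hb, diamond_aux hr hv.1 ha hb hrv hne hp, ?_⟩
    rintro z (rfl | rfl | rfl | rfl)
    exacts [⟨hr.1, Or.inl rfl⟩, ⟨hv.1, hrv⟩, ⟨ha, hr.2 v hv.1 _ ha hrv hp.1⟩,
      ⟨hb, hr.2 v hv.1 _ hb hrv hp.2.1⟩]
  by_cases h : v = r
  · refine main j w hj hw hrw ?_
    rintro rfl
    apply hij
    rw [← hv.2.1, ← hw.2.1, h]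
  · exact main i v hi hv hrv h

theorem L1 (hN : Nested G) (hc : ∀ u v, G.Adj u v → c u ≠ c v)
    (h3 : ∀ x a b x' a' b' x'' a'' b'', P3 G x a b → P3 G x' a' b' → P3 G x'' a'' b'' →
        Anti G {x, a, b} {x', a', b'} → Anti G {x, a, b} {x'', a'', b''} →
        Anti G {x', a', b'} {x'', a'', b''} → False)
    (h2 : ∀ x y a b x' y' a' b', Dia G x y a b → Dia G x' y' a' b' →
        Anti G {x, y, a, b} {x', y', a', b'} → False) :
    ∀ (n : ℕ) (A : Finset V) (S : Finset κ), S.card = n → (∀ a ∈ A, c a ∈ S) →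
      (∀ i ∈ S, ∃ v, BV G c A S i v) →
      ∃ K ⊆ A, G.IsNClique S.card K := by
  intro n
  induction n with
  | zero =>
    intro A S hS _ _
    exact ⟨∅, by simp, by rw [hS]; simp [isNClique_iff]⟩
  | succ n ih =>
    intro A S hS hcol hbv
    by_contra hno
    obtain ⟨i0, hi0⟩ := Finset.card_pos.1 (by omega : 0 < S.card)
    obtain ⟨v0, hv0⟩ := hbv i0 hi0
    obtain ⟨r0, hr0, hrv0⟩ := exists_root hN hv0.1
    by_cases hall : ∀ i ∈ S, ∃ v, BV G c A S i v ∧ Cl G r0 v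
    · apply hno
      apply step_clique hr0.1 (hcol r0 hr0.1)
      apply ih
      · rw [Finset.card_erase_of_mem (hcol r0 hr0.1)]; omega
      · exact step_colors hc hcol
      · intro i hi
        rw [Finset.mem_erase] at hi
        obtain ⟨v, hv, hrv⟩ := hall i hi.2
        exact ⟨v, hv.step hr0 hrv hi.1⟩
    · push Not at hall
      obtain ⟨i1, hi1, hn1⟩ := hall
      obtain ⟨v1, hv1⟩ := hbv i1 hi1
      have hrv01 := hn1 v1 hv1
      obtain ⟨r1, hr1, hrv1⟩ := exists_root hN hv1.1
      -- the two components are disjoint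
      have hsep : ∀ z ∈ A, Cl G r0 z → ¬ Cl G r1 z := by
        intro z hz h0 h1
        have hr01 : Cl G r0 r1 := by
          rcases h1 with rfl | h1
          · exact h0
          · exact hr0.2 z hz r1 hr1.1 h0 h1.symm
        rcases hrv1 with rfl | h
        · exact hrv01 hr01
        · exact hrv01 (hr0.2 r1 hr1.1 v1 hv1.1 hr01 h)
      have hanti : ∀ s t : Set V, (∀ z ∈ s, z ∈ A ∧ Cl G r0 z) → (∀ z ∈ t, z ∈ A ∧ Cl G r1 z) →
          Anti G s t := by
        intro s t hs ht x hx y hy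
        refine ⟨?_, ?_⟩
        · rintro rfl; exact hsep _ (hs _ hx).1 (hs _ hx).2 (ht _ hy).2
        · intro h
          exact hsep _ (ht _ hy).1 (hr0.2 _ (hs _ hx).1 _ (ht _ hy).1 (hs _ hx).2 h) (ht _ hy).2
      obtain ⟨a0, ha0, b0, hb0, hp0⟩ := center hi0 hv0 hno
      obtain ⟨a1, ha1, b1, hb1, hp1⟩ := center hi1 hv1 hno
      have hs0 : ∀ z ∈ ({v0, a0, b0} : Set V), z ∈ A ∧ Cl G r0 z := by
        rintro z (rfl | rfl | rfl)
        exacts [⟨hv0.1, hrv0⟩, ⟨ha0, hr0.2 _ hv0.1 _ ha0 hrv0 hp0.1⟩,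
          ⟨hb0, hr0.2 _ hv0.1 _ hb0 hrv0 hp0.2.1⟩]
      have hs1 : ∀ z ∈ ({v1, a1, b1} : Set V), z ∈ A ∧ Cl G r1 z := by
        rintro z (rfl | rfl | rfl)
        exacts [⟨hv1.1, hrv1⟩, ⟨ha1, hr1.2 _ hv1.1 _ ha1 hrv1 hp1.1⟩,
          ⟨hb1, hr1.2 _ hv1.1 _ hb1 hrv1 hp1.2.1⟩]
      have htwo : ∀ i ∈ S, ∀ v, BV G c A S i v → ¬ Cl G r0 v → Cl G r1 v := by
        intro i hi v hv hn0
        by_contra hn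
        obtain ⟨a, ha, b, hb, hp⟩ := center hi hv hno
        exact h3 _ _ _ _ _ _ _ _ _ hp0 hp1 hp (hanti _ _ hs0 hs1)
          (root_anti hr0 hv0.1 hv.1 ha0 hb0 ha hb hrv0 hn0 hp0 hp)
          (root_anti hr1 hv1.1 hv.1 ha1 hb1 ha hb hrv1 hn hp1 hp)
      by_cases hcase : ∀ i ∈ S, i ≠ i1 → ∃ v, BV G c A S i v ∧ Cl G r0 v
      · obtain ⟨K, hK, hcl⟩ := L2 hN hc i1 S.card (A.filter (fun x => Cl G r0 x)) S rfl
          (fun a ha => hcol a (Finset.mem_filter.1 ha).1)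
          (by
            intro x hx a hxa b hxb y hy a' hya b' hyb hp hp' han
            rw [Finset.mem_filter] at hx hxa hxb hy hya hyb
            refine h3 _ _ _ _ _ _ _ _ _ hp hp' hp1 han (hanti _ _ ?_ hs1) (hanti _ _ ?_ hs1)
            · rintro z (rfl | rfl | rfl); exacts [hx, hxa, hxb]
            · rintro z (rfl | rfl | rfl); exacts [hy, hya, hyb])
          (fun i hi => (hv0.restrict hr0 hrv0).appear hi)
          (by
            intro i hi hne
            obtain ⟨v, hv, hrv⟩ := hcase i hi hne
            exact ⟨v, hv.restrict hr0 hrv⟩)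
        exact hno ⟨K, fun x hx => (Finset.mem_filter.1 (hK hx)).1, hcl⟩
      · push Not at hcase
        obtain ⟨i2, hi2, hne2, hn2⟩ := hcase
        obtain ⟨v2, hv2⟩ := hbv i2 hi2
        have hrv2 := htwo i2 hi2 v2 hv2 (hn2 v2 hv2)
        obtain ⟨x, _, y, _, a, _, b, _, hD, hDm⟩ := diamond hr1 hi2 hi1 hne2 hv2 hv1 hrv2 hrv1 hno
        obtain ⟨K, hK, hcl⟩ := L2 hN hc i0 S.card (A.filter (fun x => Cl G r1 x)) S rfl
          (fun a ha => hcol a (Finset.mem_filter.1 ha).1)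
          (by
            intro x hx a hxa b hxb y hy a' hya b' hyb hp hp' han
            rw [Finset.mem_filter] at hx hxa hxb hy hya hyb
            refine h3 _ _ _ _ _ _ _ _ _ hp0 hp hp' (hanti _ _ hs0 ?_) (hanti _ _ hs0 ?_) han
            · rintro z (rfl | rfl | rfl); exacts [hx, hxa, hxb]
            · rintro z (rfl | rfl | rfl); exacts [hy, hya, hyb])
          (fun i hi => (hv1.restrict hr1 hrv1).appear hi)
          (by
            intro i hi hne
            obtain ⟨v, hv⟩ := hbv i hi
            refine ⟨v, hv.restrict hr1 (htwo i hi v hv ?_)⟩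
            intro hrv
            obtain ⟨x', _, y', _, a', _, b', _, hD', hDm'⟩ :=
              diamond hr0 hi hi0 hne hv hv0 hrv hrv0 hno
            exact h2 _ _ _ _ _ _ _ _ hD' hD (hanti _ _ hDm' hDm))
        exact hno ⟨K, fun x hx => (Finset.mem_filter.1 (hK hx)).1, hcl⟩

/-- In a nested graph, a pseudo-Grundy `k`-colouring yields a `k`-clique. -/
theorem grundy_clique [Fintype V] (hN : Nested G) {k : ℕ} {c : V → Fin k}
    (hc : IsPseudoGrundyColoring G c) : ∃ K : Finset V, G.IsNClique k K := by
  rcases k with _ | k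
  · exact ⟨∅, by simp [isNClique_iff]⟩
  have main : ∀ (n : ℕ) (v : V), (Finset.univ.filter (fun x => Cl G v x)).card = n →
      ∃ y, (∀ x, Cl G y x → Cl G v x) ∧
        ∀ j ≤ c v, ∃ w, (∀ x, Cl G y x → Cl G w x) ∧ c w = j := by
    intro n
    induction n using Nat.strong_induction_on with
    | _ n ih =>
      intro v hv
      by_cases hall : ∀ j ≤ c v, ∃ w, (∀ x, Cl G v x → Cl G w x) ∧ c w = j
      · exact ⟨v, fun _ h => h, hall⟩
      push Not at hall
      obtain ⟨j0, hj0, hj0'⟩ := hall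
      obtain ⟨j, hj, hmax⟩ := Finset.exists_max_image
        (Finset.univ.filter (fun j => j ≤ c v ∧ ∀ w, (∀ x, Cl G v x → Cl G w x) → c w ≠ j)) id
        ⟨j0, by simpa using ⟨hj0, hj0'⟩⟩
      simp only [Finset.mem_filter, Finset.mem_univ, true_and, id] at hj hmax
      have hlt : j < c v := lt_of_le_of_ne hj.1 (fun h => hj.2 v (fun _ h => h) h.symm)
      obtain ⟨y, hvy, hy⟩ := hc.2 v j hlt
      have hnot : ¬ ∀ x, Cl G v x → Cl G y x := fun h => hj.2 y h hy
      have hsub : ∀ x, Cl G y x → Cl G v x := by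
        push Not at hnot
        obtain ⟨b, hb1, hb2⟩ := hnot
        intro x hx
        by_contra hx'
        simp only [Cl, not_or] at hx' hb2
        rcases hb1 with rfl | hb1
        · exact hb2.2 hvy.symm
        rcases hx with rfl | hx
        · exact hx'.2 hvy
        exact hN v y b x hvy hb1.symm hb2.1 (fun h => hb2.2 h.symm) hx.symm hx'.1
          (fun h => hx'.2 h.symm)
      have hcard : (Finset.univ.filter (fun x => Cl G y x)).card < n := by
        rw [← hv]
        apply Finset.card_lt_card
        rw [Finset.ssubset_iff_of_subset]
        · push Not at hnot
          obtain ⟨b, hb1, hb2⟩ := hnot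
          exact ⟨b, by simpa using hb1, by simpa using hb2⟩
        · intro x hx
          simpa using hsub x (by simpa using hx)
      obtain ⟨y', hy1, hy2⟩ := ih _ hcard y rfl
      refine ⟨y', fun x hx => hsub x (hy1 x hx), ?_⟩
      intro l hl
      by_cases hlj : l ≤ j
      · exact hy2 l (by rw [hy]; exact hlj)
      · by_contra hcon
        push Not at hcon
        refine hlj (hmax l ⟨hl, fun w hw => hcon w (fun x hx => hw x (hsub x (hy1 x hx)))⟩)
  obtain ⟨v, hv⟩ := hc.1 (Fin.last k)
  obtain ⟨y, -, hy⟩ := main _ v rfl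
  have hy' : ∀ j, ∃ w, (∀ x, Cl G y x → Cl G w x) ∧ c w = j :=
    fun j => hy j (by rw [hv]; exact Fin.le_last j)
  choose f hf hfc using hy'
  have hinj : Function.Injective f := fun i j h => by rw [← hfc i, ← hfc j, h]
  refine ⟨Finset.univ.image f, ?_, ?_⟩
  · intro a ha b hb hab
    simp only [Finset.coe_image, Finset.coe_univ, Set.image_univ, Set.mem_range] at ha hb
    obtain ⟨i, rfl⟩ := ha
    obtain ⟨j, rfl⟩ := hb
    have h1 : Cl G (f j) y := hf j y (Or.inl rfl)
    have h2 : Cl G y (f j) := by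
      rcases h1 with h | h
      · exact Or.inl h.symm
      · exact Or.inr h.symm
    rcases hf i _ h2 with h | h
    · exact absurd h.symm hab
    · exact h
  · rw [Finset.card_image_of_injective _ hinj]; simp

theorem clique_grundy {k : ℕ} {K : Finset V} (hK : G.IsNClique k K) :
    k = 0 ∨ ∃ c : V → Fin k, IsPseudoGrundyColoring G c := by
  rcases k with _ | k
  · exact Or.inl rfl
  right
  let e : K ≃ Fin (k + 1) := K.equivFinOfCardEq hK.2
  refine ⟨fun v => if h : v ∈ K then e ⟨v, h⟩ else 0, ?_, ?_⟩
  · intro i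
    exact ⟨(e.symm i).1, by simp⟩
  · intro v j hj
    by_cases h : v ∈ K
    · refine ⟨(e.symm j).1, ?_, by simp⟩
      apply hK.1 h (e.symm j).2
      intro heq
      simp only [h, dite_true] at hj
      have : (⟨v, h⟩ : K) = e.symm j := Subtype.ext heq
      rw [this] at hj
      simp at hj
    · simp [h] at hj

theorem clique_b [Finite V] {k : ℕ} {K : Finset V} (hK : G.IsNClique k K) :
    ∃ n, k ≤ n ∧ ∃ c : V → Fin n, IsProperColoring G c ∧ IsDominatingColoring G c := by
  have hex : ∃ n, G.Colorable n := by
    have := Fintype.ofFinite V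
    exact ⟨_, G.colorable_of_fintype⟩
  set n := Nat.find hex with hn
  have hcol : G.Colorable n := Nat.find_spec hex
  obtain ⟨C⟩ := hcol
  refine ⟨n, ?_, C, fun u v h => C.valid h, ?_⟩
  · have := hK.1.card_le_of_coloring C
    rw [hK.2] at this
    simpa using this
  have hdom : ∀ i : Fin n, ∃ v : V, C v = i ∧ ∀ j : Fin n, j ≠ i → ∃ u : V, G.Adj v u ∧ C u = j := by
    intro i
    by_contra hcon
    push Not at hcon
    have hcon' : ∀ v, ∃ j : Fin n, C v = i → j ≠ i ∧ ∀ u, G.Adj v u → C u ≠ j := by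
      intro v
      by_cases hv : C v = i
      · obtain ⟨j, hj⟩ := hcon v hv
        exact ⟨j, fun _ => hj⟩
      · exact ⟨i, fun h => absurd h hv⟩
    choose g hg using hcon'
    let C' : G.Coloring {j : Fin n // j ≠ i} := Coloring.mk
      (fun v => if h : C v = i then ⟨g v, (hg v h).1⟩ else ⟨C v, h⟩) (by
        intro u v huv heq
        by_cases hu : C u = i
        · by_cases hv : C v = i
          · exact C.valid huv (hu.trans hv.symm)
          · simp only [hu, hv, dite_true, dite_false, Subtype.mk.injEq] at heq
            exact (hg u hu).2 v huv heq.symm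
        · by_cases hv : C v = i
          · simp only [hu, hv, dite_true, dite_false, Subtype.mk.injEq] at heq
            exact (hg v hv).2 u huv.symm heq
          · simp only [hu, hv, dite_false, Subtype.mk.injEq] at heq
            exact C.valid huv heq)
    have h1 := C'.colorable
    have h2 : Fintype.card {j : Fin n // j ≠ i} < n := by
      rw [Fintype.card_subtype_compl]
      simp
      exact i.pos
    exact Nat.find_min hex h2 h1
  exact ⟨fun i => (hdom i).imp fun v h => h.1, hdom⟩

end

section
variable {V W : Type*} {G : SimpleGraph V} {H : SimpleGraph W}

theorem bdd_of_surj [Finite V] {P : (k : ℕ) → (V → Fin k) → Prop}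
    (hP : ∀ k c, P k c → Function.Surjective c) : BddAbove {k | ∃ c : V → Fin k, P k c} := by
  refine ⟨Nat.card V, ?_⟩
  rintro k ⟨c, hc⟩
  simpa using Nat.card_le_card_of_surjective c (hP k c hc)

theorem le_b [Finite V] {k : ℕ} {c : V → Fin k} (h1 : IsProperColoring G c)
    (h2 : IsDominatingColoring G c) : k ≤ bChromaticNumber G :=
  le_csSup (bdd_of_surj (P := fun k c => IsProperColoring G c ∧ IsDominatingColoring G c)
    fun _ _ h => h.2.1) ⟨c, h1, h2⟩

theorem le_grundy [Finite V] {k : ℕ} {c : V → Fin k} (h : IsPseudoGrundyColoring G c) :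
    k ≤ pseudoGrundyNumber G :=
  le_csSup (bdd_of_surj (P := fun _ c => IsPseudoGrundyColoring G c) fun _ _ h => h.1) ⟨c, h⟩

theorem b_le {n : ℕ}
    (h : ∀ k (c : V → Fin k), IsProperColoring G c → IsDominatingColoring G c → k ≤ n) :
    bChromaticNumber G ≤ n := by
  unfold bChromaticNumber
  rcases Set.eq_empty_or_nonempty
    {k | ∃ c : V → Fin k, IsProperColoring G c ∧ IsDominatingColoring G c} with he | hne
  · rw [he]; simp
  · apply csSup_le hne
    rintro k ⟨c, h1, h2⟩
    exact h k c h1 h2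

theorem grundy_le {n : ℕ} (h : ∀ k (c : V → Fin k), IsPseudoGrundyColoring G c → k ≤ n) :
    pseudoGrundyNumber G ≤ n := by
  unfold pseudoGrundyNumber
  rcases Set.eq_empty_or_nonempty {k | ∃ c : V → Fin k, IsPseudoGrundyColoring G c} with he | hne
  · rw [he]; simp
  · apply csSup_le hne
    rintro k ⟨c, h1⟩
    exact h k c h1

theorem proper_iso (e : G ≃g H) {k : ℕ} {c : W → Fin k} (h : IsProperColoring H c) :
    IsProperColoring G (c ∘ e) := fun u v huv => h _ _ (e.map_rel_iff.2 huv)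

theorem dom_iso (e : G ≃g H) {k : ℕ} {c : W → Fin k} (h : IsDominatingColoring H c) :
    IsDominatingColoring G (c ∘ e) := by
  refine ⟨h.1.comp e.surjective, fun i => ?_⟩
  obtain ⟨v, hv, hv'⟩ := h.2 i
  refine ⟨e.symm v, by simpa using hv, fun j hj => ?_⟩
  obtain ⟨u, hu, hu'⟩ := hv' j hj
  exact ⟨e.symm u, e.symm.map_rel_iff.2 hu, by simpa using hu'⟩

theorem grundy_iso (e : G ≃g H) {k : ℕ} {c : W → Fin k} (h : IsPseudoGrundyColoring H c) :
    IsPseudoGrundyColoring G (c ∘ e) := by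
  refine ⟨h.1.comp e.surjective, fun v j hj => ?_⟩
  obtain ⟨u, hu, hu'⟩ := h.2 (e v) j hj
  refine ⟨e.symm u, ?_, by simpa using hu'⟩
  have := e.symm.map_rel_iff.2 hu
  simpa using this

theorem copy_of_embedding (f : H ↪g G) : HasInducedCopy G H := by
  refine ⟨Set.range f, ⟨RelIso.symm ⟨Equiv.ofInjective f f.injective, ?_⟩⟩⟩
  intro a b
  exact f.map_rel_iff

/-- Combine anticomplete embeddings. -/
def sumEmb {W' : Type*} {H' : SimpleGraph W'} (f : H ↪g G) (g : H' ↪g G)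
    (h : Anti G (Set.range f) (Set.range g)) : (H ⊕g H') ↪g G where
  toFun := Sum.elim f g
  inj' := by
    rintro (a | a) (b | b) hab
    · exact congrArg _ (f.injective hab)
    · exact absurd hab (h _ ⟨a, rfl⟩ _ ⟨b, rfl⟩).1
    · exact absurd hab.symm (h _ ⟨b, rfl⟩ _ ⟨a, rfl⟩).1
    · exact congrArg _ (g.injective hab)
  map_rel_iff' := by
    rintro (a | a) (b | b)
    · exact f.map_rel_iff.trans sum_adj_inl.symm
    · exact iff_of_false (h _ ⟨a, rfl⟩ _ ⟨b, rfl⟩).2 (by simp)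
    · exact iff_of_false (fun hh => (h _ ⟨b, rfl⟩ _ ⟨a, rfl⟩).2 hh.symm) (by simp)
    · exact g.map_rel_iff.trans sum_adj_inr.symm

theorem P3.emb {x a b : V} (h : P3 G x a b) :
    ∃ f : pathGraph 3 ↪g G, Set.range f = {x, a, b} := by
  obtain ⟨h1, h2, h3, h4⟩ := h
  refine ⟨⟨⟨![a, x, b], ?_⟩, ?_⟩, ?_⟩
  · intro i j
    fin_cases i <;> fin_cases j <;> simp [h1.ne, h2.ne, h1.ne', h2.ne', h3, h3.symm]
  · intro i j
    have h4' : ¬ G.Adj b a := fun h => h4 h.symm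
    change G.Adj (![a, x, b] i) (![a, x, b] j) ↔ _
    fin_cases i <;> fin_cases j <;> simp [pathGraph_adj, h1, h2, h1.symm, h2.symm, h4, h4']
  · ext z
    simp [Fin.exists_fin_succ, eq_comm]
    tauto

theorem Dia.emb {x y a b : V} (h : Dia G x y a b) :
    ∃ f : diamondGraph ↪g G, Set.range f = {x, y, a, b} := by
  obtain ⟨h0, ⟨h1, h2, h3, h4⟩, ⟨h5, h6, -, -⟩⟩ := h
  refine ⟨⟨⟨![a, b, x, y], ?_⟩, ?_⟩, ?_⟩
  · intro i j
    fin_cases i <;> fin_cases j <;> simp [h0.ne, h0.ne', h1.ne, h2.ne, h1.ne', h2.ne', h3, h3.symm,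
      h5.ne, h6.ne, h5.ne', h6.ne']
  · intro i j
    have h4' : ¬ G.Adj b a := fun h => h4 h.symm
    change G.Adj (![a, b, x, y] i) (![a, b, x, y] j) ↔ _
    fin_cases i <;> fin_cases j <;> simp [diamondGraph, h0, h0.symm, h1, h2, h1.symm, h2.symm, h4,
      h4', h5, h6, h5.symm, h6.symm]
  · ext z
    simp [Fin.exists_fin_succ, eq_comm]
    tauto

theorem nested_of_free (h1 : ¬ HasInducedCopy G (cycleGraph 4))
    (h2 : ¬ HasInducedCopy G (pathGraph 4)) : Nested G := by
  intro u v a b huv hau hav hav' hbv hbu hbu'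
  have hua' := hau.symm
  have hvb' := hbv.symm
  have hva' : ¬ G.Adj v a := fun h => hav' h.symm
  have hub' : ¬ G.Adj u b := fun h => hbu' h.symm
  have hab : a ≠ b := by rintro rfl; exact hav' hbv
  have hinj : Function.Injective ![a, u, v, b] := by
    intro i j
    fin_cases i <;> fin_cases j <;> simp [hau.ne, hua'.ne, hav, hav.symm, hab, hab.symm, huv.ne,
      huv.ne', hbu, hbu.symm, hbv.ne, hvb'.ne]
  by_cases h : G.Adj a b
  · have h' := h.symm
    refine h1 (copy_of_embedding ⟨⟨![a, u, v, b], hinj⟩, ?_⟩)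
    intro i j
    change G.Adj (![a, u, v, b] i) (![a, u, v, b] j) ↔ _
    fin_cases i <;> fin_cases j <;> simp [cycleGraph_adj, *, huv.symm] <;> decide
  · have h' : ¬ G.Adj b a := fun hh => h hh.symm
    refine h2 (copy_of_embedding ⟨⟨![a, u, v, b], hinj⟩, ?_⟩)
    intro i j
    change G.Adj (![a, u, v, b] i) (![a, u, v, b] j) ↔ _
    fin_cases i <;> fin_cases j <;> simp [pathGraph_adj, *, huv.symm]

theorem Nested.induce (h : Nested G) (s : Set V) : Nested (G.induce s) := by
  intro u v a b h1 h2 h3 h4 h5 h6 h7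
  exact h u v a b h1 h2 (fun h => h3 (Subtype.ext h)) h4 h5 (fun h => h6 (Subtype.ext h)) h7

theorem Anti.symm {s t : Set V} (h : Anti G s t) : Anti G t s :=
  fun x hx y hy => ⟨(h y hy x hx).1.symm, fun hh => (h y hy x hx).2 hh.symm⟩

end

end BG

namespace BG

theorem small3 (adj : Fin 4 → Fin 4 → Bool)
    (h : adj = (fun i j => decide (i - j = 1 ∨ j - i = 1)) ∨
      adj = (fun i j => decide (i.val + 1 = j.val ∨ j.val + 1 = i.val))) :
    ∀ c : Fin 4 → Fin 3, (∀ u v, adj u v → c u ≠ c v) →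
      (∀ i, ∃ v, c v = i ∧ ∀ j, j ≠ i → ∃ u, adj v u ∧ c u = j) → False := by
  rcases h with rfl | rfl <;> decide +kernel

theorem small4 (adj : Fin 4 → Fin 4 → Bool)
    (h : adj = (fun i j => decide (i - j = 1 ∨ j - i = 1)) ∨
      adj = (fun i j => decide (i.val + 1 = j.val ∨ j.val + 1 = i.val))) :
    ∀ c : Fin 4 → Fin 4, (∀ u v, adj u v → c u ≠ c v) →
      (∀ i, ∃ v, c v = i ∧ ∀ j, j ≠ i → ∃ u, adj v u ∧ c u = j) → False := by
  have hdeg : ∀ v a b d, adj v a → adj v b → adj v d → a = b ∨ a = d ∨ b = d := by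
    rcases h with rfl | rfl <;> decide +kernel
  intro c _ hd
  obtain ⟨v, -, hv⟩ := hd 0
  obtain ⟨a, ha, ha'⟩ := hv 1 (by decide)
  obtain ⟨b, hb, hb'⟩ := hv 2 (by decide)
  obtain ⟨d, hd, hd'⟩ := hv 3 (by decide)
  rcases hdeg v a b d ha hb hd with rfl | rfl | rfl
  · exact absurd (ha'.symm.trans hb') (by decide)
  · exact absurd (ha'.symm.trans hd') (by decide)
  · exact absurd (hb'.symm.trans hd') (by decide)

theorem small (H : SimpleGraph (Fin 4)) (hH : H = cycleGraph 4 ∨ H = pathGraph 4)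
    (k : ℕ) (c : Fin 4 → Fin k) (h1 : IsProperColoring H c) (h2 : IsDominatingColoring H c) :
    k ≤ 2 := by
  have hk : k ≤ 4 := by simpa using Fintype.card_le_of_surjective c h2.1
  obtain ⟨adj, hadj, hiff⟩ : ∃ adj : Fin 4 → Fin 4 → Bool,
      (adj = (fun i j => decide (i - j = 1 ∨ j - i = 1)) ∨
      adj = (fun i j => decide (i.val + 1 = j.val ∨ j.val + 1 = i.val))) ∧
      ∀ u v, H.Adj u v ↔ adj u v = true := by
    rcases hH with rfl | rfl
    · exact ⟨_, Or.inl rfl, fun u v => by simp [cycleGraph_adj]⟩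
    · exact ⟨_, Or.inr rfl, fun u v => by simp [pathGraph_adj]⟩
  unfold IsProperColoring at h1
  unfold IsDominatingColoring at h2
  simp only [hiff] at h1 h2
  by_contra hlt
  obtain rfl | rfl : k = 3 ∨ k = 4 := by omega
  · exact small3 adj hadj c h1 h2.2
  · exact small4 adj hadj c h1 h2.2

theorem grundyC4 : IsPseudoGrundyColoring (cycleGraph 4) (![0, 0, 1, 2] : Fin 4 → Fin 3) := by
  unfold IsPseudoGrundyColoring Function.Surjective
  simp only [cycleGraph_adj]
  decide

theorem grundyP4 : IsPseudoGrundyColoring (pathGraph 4) (![0, 2, 1, 0] : Fin 4 → Fin 3) := by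
  unfold IsPseudoGrundyColoring Function.Surjective
  simp only [pathGraph_adj]
  decide

theorem dom_of {V : Type*} {G : SimpleGraph V} {k : ℕ} {c : V → Fin k}
    (h : ∀ i : Fin k, ∃ v : V, c v = i ∧ ∀ j : Fin k, j ≠ i → ∃ u : V, G.Adj v u ∧ c u = j) :
    IsDominatingColoring G c := ⟨fun i => (h i).imp fun _ h => h.1, h⟩

theorem proper_sum {V W : Type*} {G : SimpleGraph V} {H : SimpleGraph W} {k : ℕ} {c : V → Fin k}
    {d : W → Fin k} (hc : IsProperColoring G c) (hd : IsProperColoring H d) :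
    IsProperColoring (G ⊕g H) (Sum.elim c d) := by
  rintro (u | u) (v | v) h
  · exact hc u v (sum_adj_inl.1 h)
  · simp at h
  · simp at h
  · exact hd u v (sum_adj_inr.1 h)

theorem proper_P3 {k : ℕ} (a b c : Fin k) (h : a ≠ b) (h' : c ≠ b) :
    IsProperColoring (pathGraph 3) ![a, b, c] := by
  intro u v
  rw [pathGraph_adj]
  fin_cases u <;> fin_cases v <;> simp [h, h', h.symm, h'.symm]

theorem dia_adj (u v : Fin 4) :
    diamondGraph.Adj u v ↔ u ≠ v ∧ ¬ (u = 0 ∧ v = 1) ∧ ¬ (u = 1 ∧ v = 0) := by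
  simp [diamondGraph]

theorem proper_D {k : ℕ} (a b x y : Fin k) (h1 : a ≠ x) (h2 : a ≠ y) (h3 : b ≠ x) (h4 : b ≠ y)
    (h5 : x ≠ y) : IsProperColoring diamondGraph ![a, b, x, y] := by
  intro u v
  rw [dia_adj]
  fin_cases u <;> fin_cases v <;>
    simp [h1, h2, h3, h4, h5, h1.symm, h2.symm, h3.symm, h4.symm, h5.symm]

theorem b3P3 : ∃ c : (Fin 3 ⊕ Fin 3) ⊕ Fin 3 → Fin 3,
    IsProperColoring ((pathGraph 3 ⊕g pathGraph 3) ⊕g pathGraph 3) c ∧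
    IsDominatingColoring ((pathGraph 3 ⊕g pathGraph 3) ⊕g pathGraph 3) c := by
  refine ⟨Sum.elim (Sum.elim ![1, 0, 2] ![0, 1, 2]) ![0, 2, 1],
    proper_sum (proper_sum ?_ ?_) ?_, dom_of ?_⟩
  · exact proper_P3 _ _ _ (by decide) (by decide)
  · exact proper_P3 _ _ _ (by decide) (by decide)
  · exact proper_P3 _ _ _ (by decide) (by decide)
  · have key : ∀ (i : Fin 3), ∃ v, (Sum.elim (Sum.elim ![1, 0, 2] ![0, 1, 2]) ![0, 2, 1] v) = i ∧
        (v = Sum.inl (Sum.inl 1) ∨ v = Sum.inl (Sum.inr 1) ∨ v = Sum.inr (1 : Fin 3)) := by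
      intro i
      fin_cases i
      exacts [⟨Sum.inl (Sum.inl 1), by simp⟩, ⟨Sum.inl (Sum.inr 1), by simp⟩,
        ⟨Sum.inr 1, by simp⟩]
    intro i
    obtain ⟨v, hv, hv'⟩ := key i
    refine ⟨v, hv, fun j hj => ?_⟩
    subst hv
    rcases hv' with rfl | rfl | rfl
    · fin_cases j
      · simp at hj
      · exact ⟨Sum.inl (Sum.inl 0), by simp [pathGraph_adj]⟩
      · exact ⟨Sum.inl (Sum.inl 2), by simp [pathGraph_adj]⟩
    · fin_cases j
      · exact ⟨Sum.inl (Sum.inr 0), by simp [pathGraph_adj]⟩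
      · simp at hj
      · exact ⟨Sum.inl (Sum.inr 2), by simp [pathGraph_adj]⟩
    · fin_cases j
      · exact ⟨Sum.inr 0, by simp [pathGraph_adj]⟩
      · exact ⟨Sum.inr 2, by simp [pathGraph_adj]⟩
      · simp at hj

theorem b2D : ∃ c : Fin 4 ⊕ Fin 4 → Fin 4,
    IsProperColoring (diamondGraph ⊕g diamondGraph) c ∧
    IsDominatingColoring (diamondGraph ⊕g diamondGraph) c := by
  refine ⟨Sum.elim ![2, 3, 0, 1] ![0, 1, 2, 3], proper_sum ?_ ?_, dom_of ?_⟩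
  · apply proper_D <;> decide
  · apply proper_D <;> decide
  · have aux : ∀ c : Fin 4 → Fin 4, (∀ j, ∃ u, c u = j) → ∀ v, (v = 2 ∨ v = 3) → ∀ j, j ≠ c v →
        ∃ u, diamondGraph.Adj v u ∧ c u = j := by
      intro c hc v hv j hj
      obtain ⟨u, rfl⟩ := hc j
      refine ⟨u, ?_, rfl⟩
      rw [dia_adj]
      refine ⟨fun h => hj (by rw [h]), ?_⟩
      rcases hv with rfl | rfl <;> simp
    have aux1 := aux ![2, 3, 0, 1] (by decide)
    have aux2 := aux ![0, 1, 2, 3] (by decide)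
    have t1 : ∀ v, (v = 2 ∨ v = 3) → ∀ j, j ≠ (![2, 3, 0, 1] : Fin 4 → Fin 4) v →
        ∃ u, (diamondGraph ⊕g diamondGraph).Adj (Sum.inl v) u ∧
          (Sum.elim ![2, 3, 0, 1] ![0, 1, 2, 3] : Fin 4 ⊕ Fin 4 → Fin 4) u = j := by
      intro v hv j hj
      obtain ⟨u, hu, hu'⟩ := aux1 v hv j hj
      exact ⟨Sum.inl u, sum_adj_inl.2 hu, hu'⟩
    have t2 : ∀ v, (v = 2 ∨ v = 3) → ∀ j, j ≠ (![0, 1, 2, 3] : Fin 4 → Fin 4) v →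
        ∃ u, (diamondGraph ⊕g diamondGraph).Adj (Sum.inr v) u ∧
          (Sum.elim ![2, 3, 0, 1] ![0, 1, 2, 3] : Fin 4 ⊕ Fin 4 → Fin 4) u = j := by
      intro v hv j hj
      obtain ⟨u, hu, hu'⟩ := aux2 v hv j hj
      exact ⟨Sum.inr u, sum_adj_inr.2 hu, hu'⟩
    intro i
    fin_cases i
    · exact ⟨Sum.inl 2, rfl, t1 2 (by simp)⟩
    · exact ⟨Sum.inl 3, rfl, t1 3 (by simp)⟩
    · exact ⟨Sum.inr 2, rfl, t2 2 (by simp)⟩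
    · exact ⟨Sum.inr 3, rfl, t2 3 (by simp)⟩

theorem col_of {V : Type*} {G : SimpleGraph V} {k : ℕ} {c : V → Fin k}
    (h : IsProperColoring G c) : G.Colorable k := ⟨Coloring.mk c (fun {u v} huv => h u v huv)⟩

theorem col3P3 : ((pathGraph 3 ⊕g pathGraph 3) ⊕g pathGraph 3).Colorable 2 := by
  have h : IsProperColoring (pathGraph 3) (![0, 1, 0] : Fin 3 → Fin 2) :=
    proper_P3 _ _ _ (by decide) (by decide)
  exact col_of (proper_sum (proper_sum h h) h)

theorem col2D : (diamondGraph ⊕g diamondGraph).Colorable 3 := by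
  have h : IsProperColoring diamondGraph (![0, 0, 1, 2] : Fin 4 → Fin 3) := by
    apply proper_D <;> decide
  exact col_of (proper_sum h h)

theorem grundy_le_of_colorable {V : Type*} [Finite V] {G : SimpleGraph V} (hN : Nested G) {n : ℕ}
    (h : G.Colorable n) : pseudoGrundyNumber G ≤ n := by
  have := Fintype.ofFinite V
  apply grundy_le
  intro k c hc
  obtain ⟨K, hK⟩ := grundy_clique hN hc
  have := hK.1.card_le_of_colorable h
  rwa [hK.2] at this

theorem b_le_of_small {V : Type*} {G : SimpleGraph V} (H : SimpleGraph (Fin 4))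
    (hH : H = cycleGraph 4 ∨ H = pathGraph 4) (e : G ≃g H) : bChromaticNumber G ≤ 2 := by
  apply b_le
  intro k c h1 h2
  exact small H hH k _ (proper_iso e.symm h1) (dom_iso e.symm h2)

end BG

open BG in
/-- `G` is bγ-perfect iff `G` has no induced subgraph isomorphic to
`C₄`, `P₄`, `3P₃`, or `2D` (where `D` is the diamond, `K₄` minus an edge). -/
theorem b_pseudoGrundy_perfect_iff_free {V : Type*} [Fintype V] (G : SimpleGraph V) :
    (∀ s : Set V, bChromaticNumber (G.induce s) = pseudoGrundyNumber (G.induce s)) ↔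
      (¬ HasInducedCopy G (cycleGraph 4) ∧ ¬ HasInducedCopy G (pathGraph 4) ∧
        ¬ HasInducedCopy G ((pathGraph 3 ⊕g pathGraph 3) ⊕g pathGraph 3) ∧
        ¬ HasInducedCopy G (diamondGraph ⊕g diamondGraph)) := by
  constructor
  · intro h
    have hC : ¬ HasInducedCopy G (cycleGraph 4) := by
      rintro ⟨s, ⟨e⟩⟩
      have h1 := b_le_of_small _ (Or.inl rfl) e
      have h2 := le_grundy (grundy_iso e grundyC4)
      have := h s
      omega
    have hP : ¬ HasInducedCopy G (pathGraph 4) := by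
      rintro ⟨s, ⟨e⟩⟩
      have h1 := b_le_of_small _ (Or.inr rfl) e
      have h2 := le_grundy (grundy_iso e grundyP4)
      have := h s
      omega
    have hN := nested_of_free hC hP
    refine ⟨hC, hP, ?_, ?_⟩
    · rintro ⟨s, ⟨e⟩⟩
      obtain ⟨c, hc1, hc2⟩ := b3P3
      have h1 := le_b (proper_iso e hc1) (dom_iso e hc2)
      have h2 := grundy_le_of_colorable (hN.induce s) (col3P3.of_hom e.toHom)
      have := h s
      omega
    · rintro ⟨s, ⟨e⟩⟩
      obtain ⟨c, hc1, hc2⟩ := b2D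
      have h1 := le_b (proper_iso e hc1) (dom_iso e hc2)
      have h2 := grundy_le_of_colorable (hN.induce s) (col2D.of_hom e.toHom)
      have := h s
      omega
  · rintro ⟨hC, hP, h3, h2⟩ s
    have hN := (nested_of_free hC hP).induce s
    have : Fintype s := Fintype.ofFinite s
    apply le_antisymm
    · apply b_le
      intro k c hc1 hc2
      obtain ⟨K, -, hK⟩ := L1 (c := c) hN hc1
        (by
          intro x a b x' a' b' x'' a'' b'' p p' p'' h12 h13 h23
          obtain ⟨f, hf⟩ := p.emb
          obtain ⟨f', hf'⟩ := p'.emb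
          obtain ⟨f'', hf''⟩ := p''.emb
          have g1 : Anti (G.induce s) (Set.range f) (Set.range f') := by rw [hf, hf']; exact h12
          have g2 : Anti (G.induce s) (Set.range (sumEmb f f' g1)) (Set.range f'') := by
            rintro _ ⟨(z | z), rfl⟩ y hy
            · exact h13 (f z) (hf ▸ ⟨z, rfl⟩) y (hf'' ▸ hy)
            · exact h23 (f' z) (hf' ▸ ⟨z, rfl⟩) y (hf'' ▸ hy)
          exact h3 (copy_of_embedding ((Embedding.induce s).comp (sumEmb _ _ g2))))
        (by
          intro x y a b x' y' a' b' p p' h12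
          obtain ⟨f, hf⟩ := p.emb
          obtain ⟨f', hf'⟩ := p'.emb
          have g1 : Anti (G.induce s) (Set.range f) (Set.range f') := by rw [hf, hf']; exact h12
          exact h2 (copy_of_embedding ((Embedding.induce s).comp (sumEmb _ _ g1))))
        k Finset.univ Finset.univ (by simp) (by simp)
        (by
          intro i _
          obtain ⟨v, hv, hv'⟩ := hc2.2 i
          refine ⟨v, Finset.mem_univ _, hv, fun j _ hj => ?_⟩
          obtain ⟨u, hu⟩ := hv' j hj
          exact ⟨u, Finset.mem_univ _, hu⟩)
      rw [Finset.card_univ, Fintype.card_fin] at hK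
      rcases clique_grundy hK with h0 | ⟨d, hd⟩
      · omega
      · exact le_grundy hd
    · apply grundy_le
      intro k c hc
      obtain ⟨K, hK⟩ := grundy_clique hN hc
      obtain ⟨n, hn, d, hd1, hd2⟩ := clique_b hK
      exact hn.trans (le_b hd1 hd2)
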